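/- Let Γ be a finite tree with a distinguished vertex A and positive edge weights (t_e)_{e∈E(Γ)}. Then for every real number T, F(Γ, A, T) = Σ_{G ⊆ E(Γ)} z(Γ, G, A) · W((2t_e)_{e∈G}; T), where the sum runs over all subsets G of the edge set of Γ (including G = ∅). -/

import Mathlib

open SimpleGraph

/-- `F` is the edge set of a rooted subtree (a connected subgraph containing the root `A`,
determined by its edge set) of the graph `G`. -/
def IsRootedSubtree {V : Type*} (G : SimpleGraph V) (A : V) (F : Set (Sym2 V)) : Prop :=
  F ⊆ G.edgeSet ∧ ∀ v : V, (∃ e ∈ F, v ∈ e) → (SimpleGraph.fromEdgeSet F).Reachable A v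

-- `z(G, Gs, A) = (-1)^{|Gs|} Σ_{Γ'} (-1)^{|E(Γ')|}`, the sum running over all rooted subtrees
-- `Γ'` of `G` (root `A`) with nonempty edge set containing `Gs`.
open scoped Classical in
noncomputable def zrel {V : Type*} [Fintype V] [DecidableEq V]
    (G : SimpleGraph V) (A : V) (Gs : Finset (Sym2 V)) : ℤ :=
  (-1 : ℤ) ^ Gs.card *
    ∑ F : Finset (Sym2 V),
      if F.Nonempty ∧ Gs ⊆ F ∧ IsRootedSubtree G A ↑F then (-1 : ℤ) ^ F.card else 0

/-- `W((2 t_e)_{e ∈ F}; T)`: the number of tuples of nonnegative integers `(n_e)_{e ∈ F}`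
with `∑_{e ∈ F} n_e · (2 t_e) ≤ T` (for `F = ∅` this is `1` if `T ≥ 0` and `0` otherwise). -/
noncomputable def Wfin {V : Type*} (F : Finset (Sym2 V)) (t : Sym2 V → ℝ) (T : ℝ) : ℕ :=
  Nat.card {n : Sym2 V → ℕ |
    (∀ e ∉ F, n e = 0) ∧ ∑ e ∈ F, (n e : ℝ) * (2 * t e) ≤ T}

/-- `F(G, A, T)`: the number of pairs `(Γ', n)` where `Γ'` is a rooted subtree (root `A`) with
nonempty edge set and `n` assigns a positive integer `n_e` to every edge `e` of `Γ'`, such that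
`∑_{e ∈ E(Γ')} 2 n_e t_e ≤ T`. -/
noncomputable def Fcount {V : Type*} (G : SimpleGraph V) (A : V) (t : Sym2 V → ℝ) (T : ℝ) : ℕ :=
  Nat.card {p : Finset (Sym2 V) × (Sym2 V → ℕ) |
    IsRootedSubtree G A ↑p.1 ∧ p.1.Nonempty ∧
    (∀ e ∈ p.1, 1 ≤ p.2 e) ∧ (∀ e ∉ p.1, p.2 e = 0) ∧
    ∑ e ∈ p.1, (p.2 e : ℝ) * (2 * t e) ≤ T}

open Finset in
/-- The signed sum over an interval of the Boolean lattice vanishes unless the interval is a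
point. -/
theorem sum_Icc_neg_one_pow_card {α : Type*} [DecidableEq α] (H F : Finset α) :
    ∑ K ∈ Finset.Icc H F, (-1 : ℤ) ^ K.card = if H = F then (-1 : ℤ) ^ F.card else 0 := by
  by_cases hHF : H ⊆ F
  · have hinj : Set.InjOn (H ∪ ·) ((F \ H).powerset : Set (Finset α)) := by
      intro K hK L hL hKL
      simp only [coe_powerset, Set.mem_preimage, Set.mem_powerset_iff, coe_subset] at hK hL
      rw [← union_sdiff_cancel_left (disjoint_sdiff.mono_right hK),
        ← union_sdiff_cancel_left (disjoint_sdiff.mono_right hL)]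
      exact congrArg (· \ H) hKL
    rw [Finset.Icc_eq_image_powerset hHF, sum_image hinj]
    have hcard : ∀ K ∈ (F \ H).powerset,
        (-1 : ℤ) ^ (H ∪ K).card = (-1 : ℤ) ^ H.card * (-1 : ℤ) ^ K.card := by
      intro K hK
      rw [card_union_of_disjoint (disjoint_sdiff.mono_right (mem_powerset.mp hK)), pow_add]
    rw [sum_congr rfl hcard, ← mul_sum, sum_powerset_neg_one_pow_card]
    by_cases h : H = F
    · simp [h]
    · have : F \ H ≠ ∅ := fun h' => h (hHF.antisymm (sdiff_eq_empty_iff_subset.mp h'))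
      simp [h, this]
  · rw [if_neg (fun h => hHF h.subset), Icc_eq_empty hHF, sum_empty]

/-- The vectors counted by `Wfin` form a finite set when the weights are positive. -/
theorem finite_setOf_weighted_sum_le {V : Type*} [Fintype V] [DecidableEq V]
    (F : Finset (Sym2 V)) (t : Sym2 V → ℝ) (ht : ∀ e ∈ F, 0 < t e) (T : ℝ) :
    {n : Sym2 V → ℕ | (∀ e ∉ F, n e = 0) ∧ ∑ e ∈ F, (n e : ℝ) * (2 * t e) ≤ T}.Finite := by
  refine (Set.finite_Icc (0 : Sym2 V → ℕ) (fun e => ⌊T / (2 * t e)⌋₊)).subset ?_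
  rintro n ⟨hn, hT⟩
  refine ⟨fun e => Nat.zero_le _, fun e => ?_⟩
  by_cases he : e ∈ F
  · have hpos : 0 < 2 * t e := mul_pos two_pos (ht e he)
    refine Nat.le_floor ((le_div_iff₀ hpos).mpr (le_trans ?_ hT))
    exact Finset.single_le_sum (f := fun e => (n e : ℝ) * (2 * t e))
      (fun i hi => mul_nonneg (Nat.cast_nonneg _) (mul_pos two_pos (ht i hi)).le) he
  · simp [hn e he]

/-- The weighted sum of a vector may be computed over any set of edges off which it vanishes. -/
theorem weighted_sum_eq_of_subset {α : Type*} {F E : Finset α} (h : F ⊆ E) (t : α → ℝ)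
    (n : α → ℕ) (hn : ∀ e ∉ F, n e = 0) :
    ∑ e ∈ F, (n e : ℝ) * (2 * t e) = ∑ e ∈ E, (n e : ℝ) * (2 * t e) :=
  Finset.sum_subset h fun e _ he => by simp [hn e he]

/-- `Wfin K t T` counts the vectors on a larger edge set `E` whose support lies in `K`. -/
theorem Wfin_eq_card_filter {V : Type*} [Fintype V] [DecidableEq V]
    {E K : Finset (Sym2 V)} (hK : K ⊆ E) (t : Sym2 V → ℝ) (T : ℝ) (S : Finset (Sym2 V → ℕ))
    (hS : ∀ n, n ∈ S ↔ (∀ e ∉ E, n e = 0) ∧ ∑ e ∈ E, (n e : ℝ) * (2 * t e) ≤ T) :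
    Wfin K t T = (S.filter fun n => Finset.univ.filter (n · ≠ 0) ⊆ K).card := by
  rw [Wfin, ← Set.ncard_coe_finset, ← Nat.card_coe_set_eq]
  congr 2
  ext n
  have hsupp : Finset.univ.filter (n · ≠ 0) ⊆ K ↔ ∀ e ∉ K, n e = 0 := by
    simp only [Finset.subset_iff, Finset.mem_filter, Finset.mem_univ, true_and]
    exact forall_congr' fun e => by tauto
  rw [Finset.mem_coe, Finset.mem_filter, hS, hsupp, Set.mem_ofPred_eq]
  constructor
  · rintro ⟨hn, hT⟩
    exact ⟨⟨fun e he => hn e fun h => he (hK h), weighted_sum_eq_of_subset hK t n hn ▸ hT⟩, hn⟩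
  · rintro ⟨⟨_, hT⟩, hn⟩
    exact ⟨hn, (weighted_sum_eq_of_subset hK t n hn).symm ▸ hT⟩

open scoped Classical in
/-- `Fcount` counts the vectors on `E(G)` whose support is a nonempty rooted subtree. -/
theorem Fcount_eq_card_filter {V : Type*} [Fintype V] [DecidableEq V]
    (G : SimpleGraph V) (A : V) (t : Sym2 V → ℝ) (T : ℝ) (S : Finset (Sym2 V → ℕ))
    (hS : ∀ n, n ∈ S ↔ (∀ e ∉ G.edgeFinset, n e = 0) ∧
      ∑ e ∈ G.edgeFinset, (n e : ℝ) * (2 * t e) ≤ T) :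
    Fcount G A t T = (S.filter fun n => (Finset.univ.filter (n · ≠ 0)).Nonempty ∧
      IsRootedSubtree G A ↑(Finset.univ.filter (n · ≠ 0))).card := by
  have hinj : Function.Injective fun n : Sym2 V → ℕ => (Finset.univ.filter (n · ≠ 0), n) :=
    fun _ _ h => congrArg Prod.snd h
  rw [Fcount, ← Set.ncard_coe_finset, ← Set.ncard_image_of_injective _ hinj,
    ← Nat.card_coe_set_eq]
  congr 2
  ext ⟨F, n⟩
  simp only [Set.mem_image, Set.mem_ofPred_eq, Finset.mem_coe, Finset.mem_filter, hS,
    Prod.mk.injEq]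
  constructor
  · rintro ⟨hF, hne, hpos, hn, hT⟩
    have hsupp : Finset.univ.filter (n · ≠ 0) = F := by
      ext e
      simp only [Finset.mem_filter, Finset.mem_univ, true_and]
      exact ⟨fun h => by_contra fun he => h (hn e he), fun he => Nat.one_le_iff_ne_zero.mp (hpos e he)⟩
    have hFE : F ⊆ G.edgeFinset := fun e he => SimpleGraph.mem_edgeFinset.mpr (hF.1 he)
    refine ⟨n, ⟨⟨fun e he => hn e fun h => he (hFE h), ?_⟩, ?_⟩, hsupp, rfl⟩
    · rwa [← weighted_sum_eq_of_subset hFE t n hn]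
    · rw [hsupp]
      exact ⟨hne, hF⟩
  · rintro ⟨m, ⟨⟨_, hT⟩, hne, hF⟩, rfl, rfl⟩
    have hFE : Finset.univ.filter (m · ≠ 0) ⊆ G.edgeFinset :=
      fun e he => SimpleGraph.mem_edgeFinset.mpr (hF.1 he)
    have hm : ∀ e ∉ Finset.univ.filter (m · ≠ 0), m e = 0 := by simp
    refine ⟨hF, hne, fun e he => ?_, hm, ?_⟩
    · exact Nat.one_le_iff_ne_zero.mpr (by simpa using he)
    · rwa [weighted_sum_eq_of_subset hFE t m hm]

open scoped Classical in
/-- Möbius inversion: the signed sums `zrel` over supersets of `H` detect whether `H` is a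
nonempty rooted subtree. -/
theorem sum_zrel_of_superset {V : Type*} [Fintype V] [DecidableEq V]
    (G : SimpleGraph V) (A : V) (H : Finset (Sym2 V)) :
    (∑ K : Finset (Sym2 V), if ↑K ⊆ G.edgeSet ∧ H ⊆ K then zrel G A K else 0) =
      if H.Nonempty ∧ IsRootedSubtree G A ↑H then 1 else 0 := by
  have hterm : ∀ K F : Finset (Sym2 V),
      (if ↑K ⊆ G.edgeSet ∧ H ⊆ K then (-1 : ℤ) ^ K.card *
        (if F.Nonempty ∧ K ⊆ F ∧ IsRootedSubtree G A ↑F then (-1 : ℤ) ^ F.card else 0) else 0) =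
      if F.Nonempty ∧ IsRootedSubtree G A ↑F then
        (-1 : ℤ) ^ F.card * (if K ∈ Finset.Icc H F then (-1 : ℤ) ^ K.card else 0) else 0 := by
    intro K F
    have hsub : K ⊆ F → IsRootedSubtree G A ↑F → (↑K : Set (Sym2 V)) ⊆ G.edgeSet :=
      fun h hF => (Finset.coe_subset.mpr h).trans hF.1
    simp only [Finset.mem_Icc]
    split_ifs <;> first | (exfalso; tauto) | ring
  calc _ = ∑ F : Finset (Sym2 V), ∑ K : Finset (Sym2 V),
        if F.Nonempty ∧ IsRootedSubtree G A ↑F then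
          (-1 : ℤ) ^ F.card * (if K ∈ Finset.Icc H F then (-1 : ℤ) ^ K.card else 0) else 0 := by
        rw [Finset.sum_comm]
        refine Finset.sum_congr rfl fun K _ => ?_
        simp only [← hterm, zrel, Finset.mul_sum]
        split_ifs <;> simp
    _ = ∑ F : Finset (Sym2 V), if H = F then
          (if F.Nonempty ∧ IsRootedSubtree G A ↑F then 1 else 0) else 0 := by
        refine Finset.sum_congr rfl fun F _ => ?_
        by_cases hF : F.Nonempty ∧ IsRootedSubtree G A ↑F
        · simp only [if_pos hF, ← Finset.mul_sum, Finset.sum_ite_mem, Finset.univ_inter,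
            sum_Icc_neg_one_pow_card]
          split_ifs
          · rw [← mul_pow]; simp
          · simp
        · simp [if_neg hF]
    _ = _ := by rw [Finset.sum_ite_eq]; simp

open scoped Classical in
/-- for a finite tree `G` with distinguished vertex `A` and positive edge weights
`t`, for every real `T`,
`F(G, A, T) = Σ_{Gs ⊆ E(G)} z(G, Gs, A) · W((2 t_e)_{e ∈ Gs}; T)`. -/
theorem Fcount_eq_sum_zrel_mul_Wfin {V : Type*} [Fintype V] [DecidableEq V]
    (G : SimpleGraph V) (A : V) (hG : G.IsTree)
    (t : Sym2 V → ℝ) (ht : ∀ e ∈ G.edgeSet, 0 < t e) (T : ℝ) :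
    (Fcount G A t T : ℤ) =
      ∑ Gs : Finset (Sym2 V),
        if ↑Gs ⊆ G.edgeSet then zrel G A Gs * (Wfin Gs t T : ℤ) else 0 := by
  have hE : ∀ e ∈ G.edgeFinset, 0 < t e := fun e he => ht e (SimpleGraph.mem_edgeFinset.mp he)
  have hfin := finite_setOf_weighted_sum_le G.edgeFinset t hE T
  have hS := fun n => hfin.mem_toFinset (a := n)
  rw [Fcount_eq_card_filter G A t T hfin.toFinset hS, Finset.card_filter]
  simp only [Nat.cast_sum, Nat.cast_ite, Nat.cast_one, Nat.cast_zero]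
  rw [Finset.sum_congr rfl fun n _ =>
    (sum_zrel_of_superset G A (Finset.univ.filter (n · ≠ 0))).symm, Finset.sum_comm]
  refine Finset.sum_congr rfl fun K _ => ?_
  by_cases hK : (↑K : Set (Sym2 V)) ⊆ G.edgeSet
  · have hKE : K ⊆ G.edgeFinset := fun e he => SimpleGraph.mem_edgeFinset.mpr (hK he)
    rw [if_pos hK, Wfin_eq_card_filter hKE t T hfin.toFinset hS, Finset.card_filter]
    push_cast
    rw [Finset.mul_sum]
    refine Finset.sum_congr rfl fun n _ => ?_
    simp [hK]
  · simp [hK]
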